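/- arXiv:2109.01865 — 2 statements merged into one kernel-verified Lean document; each statement's English description precedes it below -/
import Mathlib

section
/- Fix σ ∈ (0,1). Suppose E ∈ C¹(X,ℝ) and let p(v̄) = t_{v̄} v̄ + w_{v̄}^L be a local peak selection of E with respect to L at v̄ ∈ V_0. If (i) p is continuous at v̄, (ii) t_{v̄} > 0, and (iii) E'(p(v̄)) ≠ 0, then there exist a neighborhood N_{v̄} of v̄ and a constant α̲ > 0 such that ᾱ^A(v) ≥ α̲ for all v ∈ N_{v̄} ∩ V_0, where ᾱ^A(v) is the largest normalized Armijo-type step-size at v. -/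
open Filter Topology Set
open scoped RealInnerProductSpace ENNReal

noncomputable section

/-- The half subspace `[L, v] = {t • v + w : t ≥ 0, w ∈ L}`. -/
def halfspaceCone {X : Type*} [NormedAddCommGroup X] [InnerProductSpace ℝ X]
    (L : Submodule ℝ X) (v : X) : Set X :=
  {y | ∃ t : ℝ, 0 ≤ t ∧ ∃ w ∈ (L : Set X), y = t • v + w}

/-- The normalized gradient-step map `v(α) = (v - α g)/‖v - α g‖`. -/
def stepv {X : Type*} [NormedAddCommGroup X] [InnerProductSpace ℝ X] (v g : X) (α : ℝ) : X :=
  ‖v - α • g‖⁻¹ • (v - α • g)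

/-- The set `V₀ = {v = v⊥ + τ v₀^L ∈ S : v⊥ ∈ L⊥, 0 ≤ τ ≤ 1}`. -/
def V0 {X : Type*} [NormedAddCommGroup X] [InnerProductSpace ℝ X]
    (L : Submodule ℝ X) (v0L : X) : Set X :=
  {v | ‖v‖ = 1 ∧ ∃ w ∈ (Lᗮ : Set X), ∃ τ : ℝ, 0 ≤ τ ∧ τ ≤ 1 ∧ v = w + τ • v0L}

/-- The largest normalized Armijo-type step-size
`ᾱ^A(v) = sup{α > 0 : E(p(v(α))) < E(p(v)) − σ α t_v ‖g‖²}` (valued in `ℝ≥0∞`). -/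
def barAlphaA {X : Type*} [NormedAddCommGroup X] [InnerProductSpace ℝ X] [CompleteSpace X]
    (E : X → ℝ) (p : X → X) (σ tv : ℝ) (v : X) : ℝ≥0∞ :=
  sSup (ENNReal.ofReal ''
    {α : ℝ | 0 < α ∧
      E (p (stepv v (gradient E (p v)) α)) <
        E (p v) - σ * α * tv * ‖gradient E (p v)‖ ^ 2})

/-- The component in `Lᗮ` of a point of `V₀` does not vanish. -/
theorem exists_mem_orthogonal_inner_pos_of_mem_V0
    {X : Type*} [NormedAddCommGroup X] [InnerProductSpace ℝ X]
    {L : Submodule ℝ X} {v0perp v0L : X} (hperp : v0perp ∈ Lᗮ) (hperp0 : v0perp ≠ 0)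
    (hL : v0L ∈ L) (hnorm : ‖v0perp + v0L‖ = 1) {v : X} (hv : v ∈ V0 L v0L) :
    ∃ e ∈ Lᗮ, 0 < ⟪v, e⟫ := by
  obtain ⟨hv1, w, hw, τ, hτ0, hτ1, rfl⟩ := hv
  refine ⟨w, hw, ?_⟩
  have hτL : ⟪τ • v0L, w⟫ = 0 := hw _ (L.smul_mem τ hL)
  rw [inner_add_left, hτL, add_zero, real_inner_self_eq_norm_sq]
  have hw0 : w ≠ 0 := by
    rintro rfl
    have h1 : ‖v0perp + v0L‖ ^ 2 = ‖v0perp‖ ^ 2 + ‖v0L‖ ^ 2 := by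
      rw [norm_add_sq_real, real_inner_comm, hperp _ hL]; ring
    have h2 : 0 < ‖v0perp‖ := norm_pos_iff.2 hperp0
    rw [zero_add, norm_smul, Real.norm_of_nonneg hτ0] at hv1
    rw [hnorm] at h1
    nlinarith [norm_nonneg v0L, mul_le_mul_of_nonneg_right hτ1 (norm_nonneg v0L)]
  have := norm_pos_iff.2 hw0
  positivity

/-- The radial coefficient of a map `p u = t u • u + wL u`, `wL u ∈ L`, converges whenever `p` does,
as long as the limit direction is not in `L`. -/
theorem tendsto_radial_coeff
    {X : Type*} [NormedAddCommGroup X] [InnerProductSpace ℝ X]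
    {L : Submodule ℝ X} {l : Filter X} {v e : X} (he : e ∈ Lᗮ) (hve : 0 < ⟪v, e⟫)
    (hl : l ≤ 𝓝 v) {p wL : X → X} {t : X → ℝ}
    (hdecomp : ∀ᶠ u in l, p u = t u • u + wL u ∧ wL u ∈ L)
    (hpv : p v = t v • v + wL v ∧ wL v ∈ L) (hp : Tendsto p l (𝓝 (p v))) :
    Tendsto t l (𝓝 (t v)) := by
  have key : ∀ u, p u = t u • u + wL u ∧ wL u ∈ L → ⟪p u, e⟫ = t u * ⟪u, e⟫ := by
    rintro u ⟨h1, h2⟩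
    rw [h1, inner_add_left, he _ h2, real_inner_smul_left, add_zero]
  have hu : Tendsto (fun u : X => ⟪u, e⟫) l (𝓝 ⟪v, e⟫) :=
    (tendsto_id.mono_left hl : Tendsto (fun u : X => u) l (𝓝 v)).inner tendsto_const_nhds
  have hlim : Tendsto (fun u => ⟪p u, e⟫ / ⟪u, e⟫) l (𝓝 (⟪p v, e⟫ / ⟪v, e⟫)) :=
    (hp.inner tendsto_const_nhds).div hu hve.ne'
  rw [key v hpv, mul_div_cancel_right₀ _ hve.ne'] at hlim
  refine hlim.congr' ?_
  filter_upwards [hdecomp, hu.eventually (lt_mem_nhds hve)] with u h1 h2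
  rw [key u h1, mul_div_cancel_right₀ _ h2.ne']

/-- First-order decrease along `-g`: if `q → a`, `s → s₀`, `g → ∇E a` and `α → 0⁺`, then
`E (q - s α g) ≤ E q - c α` eventually, for each `c < s₀ ‖∇E a‖²`. -/
theorem eventually_le_sub_of_hasStrictFDerivAt
    {ι X : Type*} [NormedAddCommGroup X] [InnerProductSpace ℝ X] [CompleteSpace X]
    {E : X → ℝ} {a : X} (hE : HasStrictFDerivAt E (fderiv ℝ E a) a) {l : Filter ι}
    {q g : ι → X} {s α : ι → ℝ} {s₀ c : ℝ} (hq : Tendsto q l (𝓝 a))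
    (hs : Tendsto s l (𝓝 s₀)) (hg : Tendsto g l (𝓝 (gradient E a)))
    (hα : Tendsto α l (𝓝[>] 0)) (hc : c < s₀ * ‖gradient E a‖ ^ 2) :
    ∀ᶠ i in l, E (q i - (s i * α i) • g i) ≤ E (q i) - c * α i := by
  have hα0 : Tendsto α l (𝓝 0) := hα.mono_right nhdsWithin_le_nhds
  have hαpos : ∀ᶠ i in l, 0 < α i := hα.eventually self_mem_nhdsWithin
  have hx : Tendsto (fun i => q i - (s i * α i) • g i) l (𝓝 a) := by
    simpa using hq.sub ((hs.mul hα0).smul hg)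
  set G := gradient E a with hG
  obtain ⟨η, hη, hηc⟩ : ∃ η > 0, c < s₀ * ‖G‖ ^ 2 - η * (|s₀| * ‖G‖) := by
    have : Tendsto (fun η : ℝ => s₀ * ‖G‖ ^ 2 - η * (|s₀| * ‖G‖)) (𝓝[>] 0)
        (𝓝 (s₀ * ‖G‖ ^ 2)) := by
      have h : ContinuousAt (fun η : ℝ => s₀ * ‖G‖ ^ 2 - η * (|s₀| * ‖G‖)) 0 := by fun_prop
      simpa [ContinuousAt] using h.tendsto.mono_left nhdsWithin_le_nhds
    exact ((eventually_mem_nhdsWithin).and (this.eventually (lt_mem_nhds hc))).exists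
  have hlim : Tendsto (fun i => s i * ⟪G, g i⟫ - η * (|s i| * ‖g i‖)) l
      (𝓝 (s₀ * ‖G‖ ^ 2 - η * (|s₀| * ‖G‖))) := by
    rw [← real_inner_self_eq_norm_sq]
    exact (hs.mul (tendsto_const_nhds.inner hg)).sub
      (tendsto_const_nhds.mul (hs.abs.mul hg.norm))
  have hlo := (hE.isLittleO.comp_tendsto (hx.prodMk_nhds hq)).def hη
  filter_upwards [hlo, hαpos, hlim.eventually (lt_mem_nhds hηc)] with i h1 h2 h3
  have hinner : fderiv ℝ E a (g i) = ⟪G, g i⟫ := by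
    rw [hG, gradient, InnerProductSpace.toDual_symm_apply]
  have hsub : q i - (s i * α i) • g i - q i = -((s i * α i) • g i) := by abel
  simp only [Function.comp_apply, hsub, map_neg, map_smul, hinner, norm_neg, norm_smul,
    smul_eq_mul, norm_mul, Real.norm_eq_abs, abs_of_pos h2] at h1
  have h4 := (abs_le.1 h1).2
  nlinarith [mul_lt_mul_of_pos_right h3 h2]

theorem norm_stepv {X : Type*} [NormedAddCommGroup X] [InnerProductSpace ℝ X]
    {v g : X} {α : ℝ} (h : 0 < ‖v - α • g‖) : ‖stepv v g α‖ = 1 := by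
  rw [stepv, norm_smul, norm_inv, norm_norm, inv_mul_cancel₀ h.ne']

theorem tendsto_stepv {ι X : Type*} [NormedAddCommGroup X] [InnerProductSpace ℝ X]
    {l : Filter ι} {u g : ι → X} {α : ι → ℝ} {v g₀ : X} (hv : ‖v‖ = 1)
    (hu : Tendsto u l (𝓝 v)) (hg : Tendsto g l (𝓝 g₀)) (hα : Tendsto α l (𝓝 0)) :
    Tendsto (fun i => ‖u i - α i • g i‖) l (𝓝 1) ∧
      Tendsto (fun i => stepv (u i) (g i) (α i)) l (𝓝[{x : X | ‖x‖ = 1}] v) := by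
  have h1 : Tendsto (fun i => u i - α i • g i) l (𝓝 v) := by
    simpa using hu.sub (hα.smul hg)
  have h2 : Tendsto (fun i => ‖u i - α i • g i‖) l (𝓝 1) := hv ▸ h1.norm
  refine ⟨h2, tendsto_nhdsWithin_iff.2 ⟨?_, ?_⟩⟩
  · simpa [stepv] using (h2.inv₀ one_ne_zero).smul h1
  · filter_upwards [h2.eventually (lt_mem_nhds one_pos)] with i hi
    exact norm_stepv hi

/-- Lemma 2.10: near a point `v̄ ∈ V₀` with `p` continuous at `v̄`,
`t_{v̄} > 0` and `E'(p(v̄)) ≠ 0`, the largest normalized Armijo-type step-size is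
uniformly bounded away from zero. -/
theorem statement8
    {X : Type*} [NormedAddCommGroup X] [InnerProductSpace ℝ X] [CompleteSpace X]
    (E : X → ℝ) (hE : ContDiff ℝ 1 E)
    (σ : ℝ) (hσ : σ ∈ Set.Ioo (0 : ℝ) 1)
    (L : Submodule ℝ X) [FiniteDimensional ℝ L]
    (v0perp v0L : X) (hv0perp : v0perp ∈ Lᗮ) (hv0perp0 : v0perp ≠ 0) (hv0L : v0L ∈ L)
    (hv0norm : ‖v0perp + v0L‖ = 1)
    (vbar : X) (hvbar : vbar ∈ V0 L v0L)
    (p : X → X) (N : Set X) (hN : N ∈ nhds vbar)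
    (hpsel : ∀ u ∈ N, ‖u‖ = 1 →
      p u ∈ halfspaceCone L u ∧ IsLocalMaxOn E (halfspaceCone L u) (p u))
    (t : X → ℝ) (wL : X → X)
    (hdecomp : ∀ u ∈ N, ‖u‖ = 1 → p u = t u • u + wL u ∧ 0 ≤ t u ∧ wL u ∈ L)
    (hpc : ContinuousWithinAt p {u : X | ‖u‖ = 1} vbar)
    (htv : 0 < t vbar)
    (hg : fderiv ℝ E (p vbar) ≠ 0) :
    ∃ N' ∈ nhds vbar, ∃ αlow : ℝ, 0 < αlow ∧
      ∀ u ∈ N', u ∈ V0 L v0L → ENNReal.ofReal αlow ≤ barAlphaA E p σ (t u) u := by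
  set S : Set X := {x : X | ‖x‖ = 1} with hS
  have hv1 : ‖vbar‖ = 1 := hvbar.1
  have hvN : vbar ∈ N := mem_of_mem_nhds hN
  obtain ⟨hpv, -, hwv⟩ := hdecomp vbar hvN hv1
  obtain ⟨e, he, hve⟩ :=
    exists_mem_orthogonal_inner_pos_of_mem_V0 hv0perp hv0perp0 hv0L hv0norm hvbar
  have hNS : ∀ᶠ u in 𝓝[S] vbar, u ∈ N ∧ ‖u‖ = 1 :=
    (eventually_nhdsWithin_of_eventually_nhds hN).and eventually_mem_nhdsWithin
  have ht : Tendsto t (𝓝[S] vbar) (𝓝 (t vbar)) :=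
    tendsto_radial_coeff he hve nhdsWithin_le_nhds
      (hNS.mono fun u hu => ⟨(hdecomp u hu.1 hu.2).1, (hdecomp u hu.1 hu.2).2.2⟩)
      ⟨hpv, hwv⟩ hpc
  have hgrad : Continuous (gradient E) :=
    (InnerProductSpace.toDual ℝ X).symm.continuous.comp (hE.continuous_fderiv one_ne_zero)
  have hg0 : 0 < ‖gradient E (p vbar)‖ := by
    rw [gradient, LinearIsometryEquiv.norm_map]
    exact norm_pos_iff.2 hg
  have hgp : Tendsto (fun u => gradient E (p u)) (𝓝[S] vbar) (𝓝 (gradient E (p vbar))) :=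
    (hgrad.tendsto _).comp hpc
  have hstrict : HasStrictFDerivAt E (fderiv ℝ E (p vbar)) (p vbar) :=
    hE.contDiffAt.hasStrictFDerivAt one_ne_zero
  obtain ⟨c, hcσ, hc⟩ : ∃ c, σ * (t vbar * ‖gradient E (p vbar)‖ ^ 2) < c ∧
      c < t vbar * ‖gradient E (p vbar)‖ ^ 2 :=
    exists_between (mul_lt_of_lt_one_left (by positivity) hσ.2)
  obtain ⟨K, U, hU, hLip⟩ := hstrict.exists_lipschitzOnWith
  -- Quantities depending on a step-size `z.1` and a base point `z.2`.
  set F : Filter (ℝ × X) := 𝓝[>] 0 ×ˢ 𝓝[S] vbar with hF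
  have hα : Tendsto (fun z : ℝ × X => z.1) F (𝓝[>] 0) := tendsto_fst
  have hα0 : Tendsto (fun z : ℝ × X => z.1) F (𝓝 0) := hα.mono_right nhdsWithin_le_nhds
  have huS : Tendsto (fun z : ℝ × X => z.2) F (𝓝[S] vbar) := tendsto_snd
  have hu : Tendsto (fun z : ℝ × X => z.2) F (𝓝 vbar) := huS.mono_right nhdsWithin_le_nhds
  have hgF := hgp.comp huS
  obtain ⟨hn, hv'⟩ := tendsto_stepv hv1 hu hgF hα0
  set n : ℝ × X → ℝ := fun z => ‖z.2 - z.1 • gradient E (p z.2)‖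
  set v' : ℝ × X → X := fun z => stepv z.2 (gradient E (p z.2)) z.1
  have hpv' : Tendsto (fun z => p (v' z)) F (𝓝 (p vbar)) := hpc.tendsto.comp hv'
  have htv' : Tendsto (fun z => t (v' z)) F (𝓝 (t vbar)) := ht.comp hv'
  have hdv' : ∀ᶠ z in F, v' z ∈ N ∧ ‖v' z‖ = 1 := hv'.eventually hNS
  set s : ℝ × X → ℝ := fun z => t (v' z) * (n z)⁻¹
  have hs : Tendsto s F (𝓝 (t vbar)) := by
    simpa using htv'.mul (hn.inv₀ one_ne_zero)
  have hwL : Tendsto (fun z => wL (v' z)) F (𝓝 (wL vbar)) := by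
    have h := hpv'.sub (htv'.smul (hv'.mono_right nhdsWithin_le_nhds))
    rw [hpv, add_sub_cancel_left] at h
    refine h.congr' ?_
    filter_upwards [hdv'] with z hz
    nth_rewrite 1 [(hdecomp _ hz.1 hz.2).1]
    exact add_sub_cancel_left _ _
  have hq : Tendsto (fun z => s z • z.2 + wL (v' z)) F (𝓝 (p vbar)) := by
    rw [hpv]; exact (hs.smul hu).add hwL
  have hqbar : Tendsto (fun z => s z • vbar + wL (v' z)) F (𝓝 (p vbar)) := by
    rw [hpv]; exact (hs.smul tendsto_const_nhds).add hwL
  have hspos : ∀ᶠ z in F, 0 < s z := hs.eventually (lt_mem_nhds htv)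
  have hdecrease := eventually_le_sub_of_hasStrictFDerivAt hstrict hq hs hgF hα hc
  have hmax : ∀ᶠ z in F, E (s z • vbar + wL (v' z)) ≤ E (p vbar) := by
    have h : Tendsto (fun z => s z • vbar + wL (v' z)) F
        (𝓝[halfspaceCone L vbar] (p vbar)) := by
      refine tendsto_nhdsWithin_iff.2 ⟨hqbar, ?_⟩
      filter_upwards [hspos, hdv'] with z h1 h2
      exact ⟨s z, h1.le, _, (hdecomp _ h2.1 h2.2).2.2, rfl⟩
    exact h.eventually (hpsel vbar hvN hv1).2
  have hall : ∀ᶠ z in F, E (p (v' z)) ≤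
      E (p vbar) + K * (2 * t vbar * ‖z.2 - vbar‖) - c * z.1 := by
    filter_upwards [hdecrease, hmax, hspos, hdv', hq.eventually hU, hqbar.eventually hU,
      hs.eventually (gt_mem_nhds (show t vbar < 2 * t vbar by linarith))]
      with z h1 h2 h3 h4 h5 h6 h7
    have hpeq : p (v' z) =
        s z • z.2 + wL (v' z) - (s z * z.1) • gradient E (p z.2) := by
      have hst : t (v' z) • v' z = s z • (z.2 - z.1 • gradient E (p z.2)) := by
        simp only [v', s, n, stepv, smul_smul]
      rw [(hdecomp _ h4.1 h4.2).1, hst, smul_sub, smul_smul]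
      abel
    have hL := hLip.dist_le_mul _ h5 _ h6
    rw [dist_add_right, dist_eq_norm (s z • z.2), ← smul_sub, norm_smul, Real.dist_eq,
      Real.norm_of_nonneg h3.le]
      at hL
    have hK : (K : ℝ) * (s z * ‖z.2 - vbar‖) ≤ K * (2 * t vbar * ‖z.2 - vbar‖) := by gcongr
    have := (abs_le.1 hL).2
    simp only [Function.comp_apply] at h1
    rw [hpeq]
    linarith
  obtain ⟨α, hα1, hαpos⟩ := (hall.curry.and self_mem_nhdsWithin).exists
  have hαpos : 0 < α := hαpos
  have hlim : Tendsto (fun u => E (p u) - σ * α * t u * ‖gradient E (p u)‖ ^ 2 -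
      K * (2 * t vbar * ‖u - vbar‖)) (𝓝[S] vbar)
      (𝓝 (E (p vbar) - σ * α * t vbar * ‖gradient E (p vbar)‖ ^ 2 -
        K * (2 * t vbar * ‖vbar - vbar‖))) := by
    have hid : Tendsto (fun u : X => u) (𝓝[S] vbar) (𝓝 vbar) := nhdsWithin_le_nhds
    exact (((hE.continuous.tendsto _).comp hpc).sub
      ((ht.const_mul _).mul (hgp.norm.pow 2))).sub
      (((hid.sub_const vbar).norm.const_mul _).const_mul _)
  have hlt : E (p vbar) - c * α < E (p vbar) - σ * α * t vbar * ‖gradient E (p vbar)‖ ^ 2 -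
        K * (2 * t vbar * ‖vbar - vbar‖) := by
    rw [sub_self, norm_zero]
    nlinarith [mul_lt_mul_of_pos_right hcσ hαpos]
  refine ⟨_, mem_nhdsWithin_iff_eventually.1 (hα1.and (hlim.eventually (lt_mem_nhds hlt))),
    α, hαpos, fun u hu huV => ?_⟩
  obtain ⟨h1, h2⟩ := hu huV.1
  refine le_sSup ⟨α, ⟨hαpos, ?_⟩, rfl⟩
  change E (p (v' (α, u))) < _
  simp only at h1
  linarith
end
end

section
/- Assume E ∈ C¹(X,ℝ) has a peak selection p with respect to L. Let {v_j}_{j=0}^k ⊆ V_0 be a sequence generated by the normalized ZH-type nonmonotone LMM (Algorithm 2) with g_j = ∇E(p(v_j)) ≠ 0 for all j = 0,1,…,k, for some k ≥ 0. If (i) p is continuous on V_0 and (ii) t_j > 0 for all j = 0,1,…,k, then for each j = 0,1,…,k there exists α_j^A > 0 such that E(p(v_j(α))) < C_j − σ α t_j ‖g_j‖² for all α ∈ (0, α_j^A). -/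
open Filter Topology Set
open scoped RealInnerProductSpace ENNReal

noncomputable section

section Aux

variable {X : Type*} [NormedAddCommGroup X] [InnerProductSpace ℝ X]

/-- A differentiable function has vanishing directional derivative along any direction in which
a local maximizer relative to a set can be moved both ways. -/
lemma inner_gradient_eq_zero_of_isLocalMaxOn [CompleteSpace X] {E : X → ℝ} {s : Set X} {x d : X}
    (hE : DifferentiableAt ℝ E x) (hmax : IsLocalMaxOn E s x)
    (hs : ∀ᶠ r : ℝ in 𝓝 0, x + r • d ∈ s) : ⟪gradient E x, d⟫ = 0 := by
  have hline : HasDerivAt (fun r : ℝ => x + r • d) d 0 := by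
    simpa using ((hasDerivAt_id (0 : ℝ)).smul_const d).const_add x
  have hx : x + (0 : ℝ) • d = x := by simp
  have hderiv : HasDerivAt (fun r : ℝ => E (x + r • d)) (fderiv ℝ E x d) 0 :=
    HasFDerivAt.comp_hasDerivAt (0 : ℝ) (by rw [hx]; exact hE.hasFDerivAt) hline
  have hcont : Tendsto (fun r : ℝ => x + r • d) (𝓝 0) (𝓝 x) := by
    simpa [ContinuousAt] using hline.continuousAt
  have hloc : IsLocalMax (fun r : ℝ => E (x + r • d)) 0 := by
    have := (tendsto_nhdsWithin_iff.2 ⟨hcont, hs⟩).eventually hmax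
    filter_upwards [this] with r hr
    simpa using hr
  rw [inner_gradient_left]
  exact hloc.hasDerivAt_eq_zero hderiv

/-- At a local maximizer `t • v + w` on `[L, v]` with `t > 0`, the gradient is orthogonal to
`v` and to `L`. -/
lemma inner_gradient_eq_zero_of_isLocalMaxOn_halfspaceCone [CompleteSpace X] {E : X → ℝ}
    {L : Submodule ℝ X} {v w : X} {t : ℝ} (hE : Differentiable ℝ E) (ht : 0 < t) (hw : w ∈ L)
    (hmax : IsLocalMaxOn E (halfspaceCone L v) (t • v + w)) :
    ⟪gradient E (t • v + w), v⟫ = 0 ∧ ∀ z ∈ L, ⟪gradient E (t • v + w), z⟫ = 0 := by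
  refine ⟨inner_gradient_eq_zero_of_isLocalMaxOn (hE _) hmax ?_, fun z hz =>
    inner_gradient_eq_zero_of_isLocalMaxOn (hE _) hmax (Eventually.of_forall fun r => ?_)⟩
  · filter_upwards [lt_mem_nhds (show -t < 0 by linarith)] with r hr
    exact ⟨t + r, by linarith, w, hw, by rw [add_smul]; abel⟩
  · exact ⟨t, ht.le, w + r • z, L.add_mem hw (L.smul_mem r hz), by abel⟩

lemma norm_sub_smul_sq {v g : X} (hv : ‖v‖ = 1) (hgv : ⟪g, v⟫ = 0) (a : ℝ) :
    ‖v - a • g‖ ^ 2 = 1 + a ^ 2 * ‖g‖ ^ 2 := by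
  rw [norm_sub_sq_real, inner_smul_right, real_inner_comm, hgv, norm_smul, hv, mul_pow,
    Real.norm_eq_abs, sq_abs]
  ring

lemma one_le_norm_sub_smul {v g : X} (hv : ‖v‖ = 1) (hgv : ⟪g, v⟫ = 0) (a : ℝ) :
    1 ≤ ‖v - a • g‖ := by
  have := norm_sub_smul_sq hv hgv a
  nlinarith [norm_nonneg (v - a • g), mul_nonneg (sq_nonneg a) (sq_nonneg ‖g‖)]

lemma norm_stepv_s10 {v g : X} (hv : ‖v‖ = 1) (hgv : ⟪g, v⟫ = 0) (a : ℝ) : ‖stepv v g a‖ = 1 := by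
  have := one_le_norm_sub_smul hv hgv a
  rw [stepv, norm_smul, norm_inv, norm_norm, inv_mul_cancel₀ (by linarith)]

lemma inner_stepv_sub {v g : X} (hgv : ⟪g, v⟫ = 0) (a : ℝ) :
    ⟪g, stepv v g a - v⟫ = -(a * ‖g‖ ^ 2 * ‖v - a • g‖⁻¹) := by
  rw [stepv, inner_sub_right, inner_smul_right, inner_sub_right, inner_smul_right, hgv,
    real_inner_self_eq_norm_sq]
  ring

lemma norm_stepv_sub_le {v g : X} (hv : ‖v‖ = 1) (hgv : ⟪g, v⟫ = 0) {a : ℝ} (ha : 0 ≤ a) :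
    ‖stepv v g a - v‖ ≤ 2 * (a * ‖g‖) := by
  have h1 := one_le_norm_sub_smul hv hgv a
  have h2 : ‖v - a • g‖ ≤ 1 + a * ‖g‖ := by
    simpa [norm_smul, hv, abs_of_nonneg ha] using norm_sub_le v (a • g)
  have h3 : ‖stepv v g a - (v - a • g)‖ ≤ a * ‖g‖ := by
    have h0 : ‖v - a • g‖ ≠ 0 := by linarith
    have : stepv v g a - (v - a • g) = (1 - ‖v - a • g‖) • stepv v g a := by
      rw [sub_smul, one_smul, show ‖v - a • g‖ • stepv v g a = v - a • g from smul_inv_smul₀ h0 _]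
    rw [this, norm_smul, norm_stepv_s10 hv hgv, mul_one, Real.norm_eq_abs, abs_sub_comm,
      abs_of_nonneg (by linarith)]
    linarith
  calc ‖stepv v g a - v‖ = ‖(stepv v g a - (v - a • g)) + -(a • g)‖ := by congr 1; abel
    _ ≤ ‖stepv v g a - (v - a • g)‖ + ‖-(a • g)‖ := norm_add_le _ _
    _ ≤ 2 * (a * ‖g‖) := by
      rw [norm_neg, norm_smul, Real.norm_eq_abs, abs_of_nonneg ha]
      linarith

lemma tendsto_norm_sub_smul {v : X} (hv : ‖v‖ = 1) (g : X) :
    Tendsto (fun a : ℝ => ‖v - a • g‖) (𝓝 0) (𝓝 1) := by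
  have : Continuous fun a : ℝ => ‖v - a • g‖ := by fun_prop
  simpa [hv] using this.tendsto 0

lemma tendsto_stepv_s10 {v : X} (hv : ‖v‖ = 1) (g : X) :
    Tendsto (stepv v g) (𝓝 0) (𝓝 v) := by
  have h : Continuous fun a : ℝ => v - a • g := by fun_prop
  have hlim := ((tendsto_norm_sub_smul hv g).inv₀ one_ne_zero).smul (h.tendsto 0)
  rw [inv_one, one_smul, zero_smul, sub_zero] at hlim
  exact hlim

/-- Gradient steps orthogonal to `v` and `L` stay in `V0`. -/
lemma stepv_mem_V0 {L : Submodule ℝ X} {v0L v g : X} (hv : v ∈ V0 L v0L) (hgv : ⟪g, v⟫ = 0)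
    (hg : g ∈ Lᗮ) (a : ℝ) : stepv v g a ∈ V0 L v0L := by
  obtain ⟨hnorm, w, hw, τ, hτ0, hτ1, hdec⟩ := hv
  have h1 := one_le_norm_sub_smul hnorm hgv a
  refine ⟨norm_stepv_s10 hnorm hgv a, ‖v - a • g‖⁻¹ • (w - a • g),
    Lᗮ.smul_mem _ (Lᗮ.sub_mem hw (Lᗮ.smul_mem a hg)), ‖v - a • g‖⁻¹ * τ, by positivity, ?_, ?_⟩
  · exact mul_le_one₀ (inv_le_one_of_one_le₀ h1) hτ0 hτ1
  · rw [stepv, mul_smul, ← smul_add]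
    congr 1
    nth_rewrite 1 [hdec]
    abel

/-- The orthogonal component of an element of `V0` does not vanish. -/
lemma exists_orthogonal_of_mem_V0 {L : Submodule ℝ X} {v0perp v0L v : X} (hperp : v0perp ∈ Lᗮ)
    (hperp0 : v0perp ≠ 0) (hv0L : v0L ∈ L) (hnorm : ‖v0perp + v0L‖ = 1) (hv : v ∈ V0 L v0L) :
    ∃ w ∈ Lᗮ, ⟪v, w⟫ ≠ 0 := by
  obtain ⟨hv1, w, hw, τ, hτ0, hτ1, hdec⟩ := hv
  refine ⟨w, hw, ?_⟩
  have horth : ⟪v, w⟫ = ⟪w, w⟫ := by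
    rw [hdec, inner_add_left, inner_smul_left, Submodule.inner_right_of_mem_orthogonal hv0L hw]
    simp
  rw [horth]
  intro h
  have hw0 : w = 0 := inner_self_eq_zero.1 h
  have hlt : ‖v0L‖ < 1 := by
    have h1 := norm_add_sq_real v0perp v0L
    rw [Submodule.inner_left_of_mem_orthogonal hv0L hperp, hnorm] at h1
    have := norm_pos_iff.2 hperp0
    nlinarith [norm_nonneg v0L]
  rw [hdec, hw0, zero_add, norm_smul, Real.norm_eq_abs, abs_of_nonneg hτ0] at hv1
  nlinarith [norm_nonneg v0L]

/-- The coefficient `t` of the decomposition `p u = t u • u + wL u` depends continuously on `u`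
wherever `p` does, along unit vectors approaching a point outside `L`. -/
lemma tendsto_coeff {ι : Type*} {l : Filter ι} {L : Submodule ℝ X} {p wL : X → X} {t : X → ℝ}
    (hdecomp : ∀ u : X, ‖u‖ = 1 → p u = t u • u + wL u ∧ 0 ≤ t u ∧ wL u ∈ L)
    {v w : X} (hv : ‖v‖ = 1) (hw : w ∈ Lᗮ) (hvw : ⟪v, w⟫ ≠ 0) {u : ι → X}
    (hu1 : ∀ i, ‖u i‖ = 1) (hu : Tendsto u l (𝓝 v))
    (hp : Tendsto (fun i => p (u i)) l (𝓝 (p v))) :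
    Tendsto (fun i => t (u i)) l (𝓝 (t v)) := by
  have key : ∀ x : X, ‖x‖ = 1 → ⟪p x, w⟫ = t x * ⟪x, w⟫ := fun x hx => by
    obtain ⟨h, -, hL⟩ := hdecomp x hx
    rw [h, inner_add_left, inner_smul_left, Submodule.inner_right_of_mem_orthogonal hL hw]
    simp
  have huw := hu.inner (𝕜 := ℝ) (tendsto_const_nhds (x := w))
  have hdiv := (hp.inner (𝕜 := ℝ) (tendsto_const_nhds (x := w))).div huw hvw
  rw [key v hv, mul_div_cancel_right₀ _ hvw] at hdiv
  refine hdiv.congr' ?_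
  filter_upwards [huw.eventually_ne hvw] with i hi
  simp only [Pi.div_apply]
  rw [key _ (hu1 i), mul_div_cancel_right₀ _ hi]

/-- Sufficient decrease of `E ∘ p` along the normalized gradient step. -/
lemma eventually_stepv_lt [CompleteSpace X] {E : X → ℝ} (hE : ContDiff ℝ 1 E)
    {L : Submodule ℝ X} {v0L v w : X} {p wL : X → X} {t : X → ℝ}
    (hdecomp : ∀ u : X, ‖u‖ = 1 → p u = t u • u + wL u ∧ 0 ≤ t u ∧ wL u ∈ L)
    (hmax : IsLocalMaxOn E (halfspaceCone L v) (p v))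
    (hv : v ∈ V0 L v0L) (hw : w ∈ Lᗮ) (hvw : ⟪v, w⟫ ≠ 0)
    (hpc : ContinuousOn p (V0 L v0L)) (ht : 0 < t v) (hg : gradient E (p v) ≠ 0)
    {σ : ℝ} (hσ : σ < 1) :
    ∀ᶠ a : ℝ in 𝓝[>] 0, E (p (stepv v (gradient E (p v)) a)) <
      E (p v) - σ * a * t v * ‖gradient E (p v)‖ ^ 2 := by
  have hv1 := hv.1
  obtain ⟨hpv, -, hwL⟩ := hdecomp v hv1
  have hdiff := hE.differentiable one_ne_zero
  obtain ⟨hgv, hgL⟩ : ⟪gradient E (p v), v⟫ = 0 ∧ ∀ z ∈ L, ⟪gradient E (p v), z⟫ = 0 := by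
    rw [hpv] at hmax ⊢
    exact inner_gradient_eq_zero_of_isLocalMaxOn_halfspaceCone hdiff ht hwL hmax
  have hstrict := hE.contDiffAt.hasStrictFDerivAt (x := p v) one_ne_zero
  have hinner : ∀ d, fderiv ℝ E (p v) d = ⟪gradient E (p v), d⟫ := fun d =>
    inner_gradient_left.symm
  set g := gradient E (p v)
  have hg0 : 0 < ‖g‖ := norm_pos_iff.2 hg
  have hgperp : g ∈ Lᗮ := (Submodule.mem_orthogonal' L g).2 hgL
  have hu1 := norm_stepv_s10 hv1 hgv
  have hu : Tendsto (stepv v g) (𝓝 0) (𝓝 v) := tendsto_stepv_s10 hv1 g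
  have hpu : Tendsto (fun a => p (stepv v g a)) (𝓝 0) (𝓝 (p v)) :=
    (hpc v hv).tendsto.comp (tendsto_nhdsWithin_iff.2
      ⟨hu, Eventually.of_forall (stepv_mem_V0 hv hgv hgperp)⟩)
  have htu : Tendsto (fun a => t (stepv v g a)) (𝓝 0) (𝓝 (t v)) :=
    tendsto_coeff hdecomp hv1 hw hvw hu1 hu hpu
  let q : ℝ → X := fun a => t (stepv v g a) • v + wL (stepv v g a)
  have hpq : ∀ a, p (stepv v g a) - q a = t (stepv v g a) • (stepv v g a - v) := fun a => by
    rw [(hdecomp _ (hu1 a)).1, smul_sub]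
    simp only [q]
    abel
  have hq : Tendsto q (𝓝 0) (𝓝 (p v)) := by
    have := hpu.sub (htu.smul (hu.sub_const v))
    simp only [← hpq, sub_sub_cancel, sub_self, smul_zero, sub_zero] at this
    exact this
  have hqmem : ∀ a, q a ∈ halfspaceCone L v := fun a =>
    ⟨_, (hdecomp _ (hu1 a)).2.1, _, (hdecomp _ (hu1 a)).2.2, rfl⟩
  have hEq : ∀ᶠ a in 𝓝 0, E (q a) ≤ E (p v) :=
    (tendsto_nhdsWithin_iff.2 ⟨hq, Eventually.of_forall hqmem⟩).eventually hmax
  have hε : 0 < (1 - σ) * ‖g‖ / 4 := div_pos (mul_pos (by linarith) hg0) four_pos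
  have hlin := (hpu.prodMk_nhds hq).eventually (hstrict.isLittleO.def hε)
  have hcoef : ∀ᶠ a in 𝓝 0,
      σ * t v < t (stepv v g a) * (‖v - a • g‖⁻¹ - (1 - σ) / 2) := by
    refine (htu.mul (((tendsto_norm_sub_smul hv1 g).inv₀ one_ne_zero).sub_const
      ((1 - σ) / 2))).eventually_const_lt ?_
    rw [inv_one]
    nlinarith
  filter_upwards [nhdsWithin_le_nhds hEq, nhdsWithin_le_nhds hlin, nhdsWithin_le_nhds hcoef,
    self_mem_nhdsWithin] with a hEqa hlina hcoefa ha
  have ha : 0 < a := ha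
  have htnn := (hdecomp _ (hu1 a)).2.1
  simp only [hpq, hinner, inner_smul_right, inner_stepv_sub hgv, norm_smul, Real.norm_eq_abs,
    abs_of_nonneg htnn] at hlina
  have hbound := mul_le_mul_of_nonneg_left (mul_le_mul_of_nonneg_left
    (norm_stepv_sub_le hv1 hgv ha.le) htnn) hε.le
  have hscaled := mul_lt_mul_of_pos_right hcoefa (show 0 < a * ‖g‖ ^ 2 by positivity)
  have := (abs_le.1 hlina).2
  linarith

/-- The Zhang–Hager reference values dominate the function values. -/
lemma le_reference_value {k : ℕ} {f C Q η : ℕ → ℝ} (hQ0 : Q 0 = 1) (hC0 : C 0 = f 0)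
    (hη : ∀ j < k, 0 ≤ η j) (hQ : ∀ j < k, Q (j + 1) = η j * Q j + 1)
    (hC : ∀ j < k, C (j + 1) = (η j * Q j * C j + f (j + 1)) / Q (j + 1))
    (hf : ∀ j < k, f (j + 1) ≤ C j) : ∀ j ≤ k, f j ≤ C j := by
  have hQpos : ∀ j ≤ k, 0 < Q j := by
    intro j
    induction j with
    | zero => intro _; simp [hQ0]
    | succ j ih =>
      intro hj
      rw [hQ j hj]
      have := mul_nonneg (hη j hj) (ih (by omega)).le
      linarith
  rintro (_ | j) hj
  · exact hC0.ge
  · rw [hC j hj, le_div_iff₀ (hQpos _ hj), hQ j hj]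
    nlinarith [mul_le_mul_of_nonneg_left (hf j hj)
      (mul_nonneg (hη j hj) (hQpos j (by omega)).le)]

end Aux

/-- Theorem 3.3, feasibility of Algorithm 2: along a sequence
`{v_j}_{j=0}^k ⊆ V₀` generated by the normalized ZH-type nonmonotone LMM with
`g_j ≠ 0` and `t_j > 0` for `j = 0,…,k` and `p` continuous on `V₀`, at every
`j ≤ k` a ZH-type step-size search is feasible. -/
theorem statement10
    {X : Type*} [NormedAddCommGroup X] [InnerProductSpace ℝ X] [CompleteSpace X]
    (E : X → ℝ) (hE : ContDiff ℝ 1 E)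
    (L : Submodule ℝ X) [FiniteDimensional ℝ L]
    (v0perp v0L : X) (hv0perp : v0perp ∈ Lᗮ) (hv0perp0 : v0perp ≠ 0) (hv0L : v0L ∈ L)
    (hv0norm : ‖v0perp + v0L‖ = 1)
    (p : X → X)
    (hpsel : ∀ u : X, ‖u‖ = 1 →
      p u ∈ halfspaceCone L u ∧ IsLocalMaxOn E (halfspaceCone L u) (p u))
    (t : X → ℝ) (wL : X → X)
    (hdecomp : ∀ u : X, ‖u‖ = 1 → p u = t u • u + wL u ∧ 0 ≤ t u ∧ wL u ∈ L)
    (σ ρ : ℝ) (hσ : σ ∈ Set.Ioo (0 : ℝ) 1) (hρ : ρ ∈ Set.Ioo (0 : ℝ) 1)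
    (lmin lmax : ℝ) (hlmin : 0 < lmin) (hlle : lmin ≤ lmax)
    (ηmin ηmax : ℝ) (hηmin : 0 ≤ ηmin) (hηlt : ηmin < ηmax) (hηmax : ηmax ≤ 1)
    (k : ℕ)
    (lam η : ℕ → ℝ) (m : ℕ → ℕ) (α : ℕ → ℝ)
    (hlam : ∀ j < k, lam j ∈ Set.Icc lmin lmax)
    (hη : ∀ j < k, η j ∈ Set.Icc ηmin ηmax)
    (v : ℕ → X) (Q C : ℕ → ℝ)
    (hv00 : v 0 = v0perp + v0L)
    (hQ0 : Q 0 = 1) (hC0 : C 0 = E (p (v 0)))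
    (hαdef : ∀ j < k, α j = lam j * ρ ^ m j)
    (hZH : ∀ j < k,
      E (p (stepv (v j) (gradient E (p (v j))) (α j))) ≤
        C j - σ * α j * t (v j) * ‖gradient E (p (v j))‖ ^ 2)
    (hmmin : ∀ j < k, ∀ m' < m j,
      ¬ (E (p (stepv (v j) (gradient E (p (v j))) (lam j * ρ ^ m'))) ≤
        C j - σ * (lam j * ρ ^ m') * t (v j) * ‖gradient E (p (v j))‖ ^ 2))
    (hrecv : ∀ j < k, v (j + 1) = stepv (v j) (gradient E (p (v j))) (α j))
    (hrecQ : ∀ j < k, Q (j + 1) = η j * Q j + 1)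
    (hrecC : ∀ j < k, C (j + 1) = (η j * Q j * C j + E (p (v (j + 1)))) / Q (j + 1))
    (hV0 : ∀ j ≤ k, v j ∈ V0 L v0L)
    (hpc : ContinuousOn p (V0 L v0L))
    (ht : ∀ j ≤ k, 0 < t (v j))
    (hg : ∀ j ≤ k, gradient E (p (v j)) ≠ 0) :
    ∀ j ≤ k, ∃ αA > 0, ∀ a : ℝ, 0 < a → a < αA →
      E (p (stepv (v j) (gradient E (p (v j))) a)) <
        C j - σ * a * t (v j) * ‖gradient E (p (v j))‖ ^ 2 := by
  intro j hj
  have hdec : ∀ i < k, E (p (v (i + 1))) ≤ C i := fun i hi => by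
    have hα : 0 < α i := by
      rw [hαdef i hi]
      exact mul_pos (hlmin.trans_le (hlam i hi).1) (pow_pos hρ.1 _)
    have hnn : 0 ≤ σ * α i * t (v i) * ‖gradient E (p (v i))‖ ^ 2 :=
      mul_nonneg (mul_pos (mul_pos hσ.1 hα) (ht i hi.le)).le (sq_nonneg _)
    rw [hrecv i hi]
    linarith [hZH i hi]
  have hCj : E (p (v j)) ≤ C j :=
    le_reference_value (f := fun i => E (p (v i))) hQ0 hC0
      (fun i hi => hηmin.trans (hη i hi).1) hrecQ hrecC hdec j hj
  obtain ⟨w, hw, hvw⟩ :=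
    exists_orthogonal_of_mem_V0 hv0perp hv0perp0 hv0L hv0norm (hV0 j hj)
  have hev := eventually_stepv_lt hE hdecomp (hpsel _ (hV0 j hj).1).2 (hV0 j hj) hw hvw hpc
    (ht j hj) (hg j hj) hσ.2
  obtain ⟨αA, hαA, hsub⟩ := mem_nhdsGT_iff_exists_Ioo_subset.1 hev
  refine ⟨αA, hαA, fun a ha0 ha => ?_⟩
  have : E (p (stepv (v j) (gradient E (p (v j))) a)) <
      E (p (v j)) - σ * a * t (v j) * ‖gradient E (p (v j))‖ ^ 2 := hsub ⟨ha0, ha⟩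
  linarith
end
end
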